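/- arXiv:math/0303360 — 2 statements merged into one kernel-verified Lean document; each statement's English description precedes it below -/
import Mathlib

section
/- Let f, g : [a,b] → 𝕜 be Lebesgue integrable functions (with a < b) and let φ, Φ, γ, Γ ∈ 𝕜 be such that Re[(Φ − f(x))(conj(f(x)) − conj(φ))] ≥ 0 and Re[(Γ − g(x))(conj(g(x)) − conj(γ))] ≥ 0 for almost every x ∈ [a,b]. Then |(1/(b−a))∫_a^b f(x)·conj(g(x)) dx − (1/(b−a))∫_a^b f(x) dx · (1/(b−a))∫_a^b conj(g(x)) dx| ≤ (1/4)·|Φ − φ|·|Γ − γ|. -/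
open MeasureTheory

lemma norm_sub_midpoint_le_of_re_nonneg {𝕜 : Type*} [RCLike 𝕜] {z w W : 𝕜}
    (h : 0 ≤ RCLike.re ((W - z) * ((starRingEnd 𝕜) z - (starRingEnd 𝕜) w))) :
    ‖z - (w + W) / 2‖ ≤ ‖W - w‖ / 2 := by
  have key : ‖2 * z - (w + W)‖ ≤ ‖W - w‖ := by
    rw [← sq_le_sq₀ (norm_nonneg _) (norm_nonneg _), ← RCLike.normSq_eq_def',
      ← RCLike.normSq_eq_def', RCLike.normSq_apply, RCLike.normSq_apply]
    simp only [two_mul, RCLike.mul_re, map_sub, map_add, RCLike.conj_re,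
      RCLike.conj_im] at h ⊢
    nlinarith
  have : z - (w + W) / 2 = (2 * z - (w + W)) / 2 := by ring
  rw [this, norm_div, RCLike.norm_ofNat]
  gcongr

lemma integral_norm_sub_integral_le {α 𝕜 : Type*} [MeasurableSpace α] [RCLike 𝕜] {μ : Measure α}
    [IsProbabilityMeasure μ] {f : α → 𝕜} (hf : Integrable f μ) {c : 𝕜} {R : ℝ}
    (hR : ∀ᵐ x ∂μ, ‖f x - c‖ ≤ R) :
    ∫ x, ‖f x - ∫ y, f y ∂μ‖ ∂μ ≤ R := by
  obtain ⟨x₀, hx₀⟩ := hR.exists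
  have hR₀ : 0 ≤ R := (norm_nonneg _).trans hx₀
  set m : 𝕜 := ∫ y, f y ∂μ with hm
  have hfc : Integrable (fun x => f x - c) μ := hf.sub (integrable_const c)
  have hfc_int : ∫ x, f x - c ∂μ = m - c := by
    rw [integral_sub hf (integrable_const c)]
    simp [hm]
  have hfm : Integrable (fun x => ‖f x - m‖) μ := (hf.sub (integrable_const m)).norm
  rcases hR₀.eq_or_lt with rfl | hpos
  · have hmc : m = c := by
      refine sub_eq_zero.1 (hfc_int.symm.trans (integral_eq_zero_of_ae ?_))
      filter_upwards [hR] with x hx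
      simpa using hx
    have := integral_mono_ae hfm (integrable_const 0) (by rwa [hmc])
    simpa using this
  · have hinner : Integrable (fun x => (starRingEnd 𝕜) (m - c) * (f x - c)) μ := hfc.const_mul _
    have hre : ∫ x, RCLike.re ((starRingEnd 𝕜) (m - c) * (f x - c)) ∂μ = ‖m - c‖ ^ 2 := by
      rw [integral_re hinner, integral_const_mul, hfc_int, RCLike.conj_mul]
      norm_cast
    have hle : ∫ x, R * ‖f x - m‖ ∂μ ≤
        ∫ x, (R ^ 2 + ‖m - c‖ ^ 2 / 2) -
          RCLike.re ((starRingEnd 𝕜) (m - c) * (f x - c)) ∂μ := by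
      refine integral_mono_ae (hfm.const_mul R) ((integrable_const _).sub hinner.re) ?_
      filter_upwards [hR] with x hx
      have hsq : ‖f x - m‖ ^ 2 = ‖f x - c‖ ^ 2 -
          2 * RCLike.re ((starRingEnd 𝕜) (m - c) * (f x - c)) + ‖m - c‖ ^ 2 := by
        simp only [← RCLike.normSq_eq_def', RCLike.normSq_apply, RCLike.mul_re, map_sub,
          RCLike.conj_re, RCLike.conj_im]
        ring
      have : ‖f x - c‖ ^ 2 ≤ R ^ 2 := by gcongr
      nlinarith [sq_nonneg (R - ‖f x - m‖)]
    rw [integral_const_mul, integral_sub (integrable_const _) hinner.re, hre] at hle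
    simp only [integral_const, probReal_univ, one_smul] at hle
    nlinarith [sq_nonneg ‖m - c‖]

lemma norm_integral_mul_conj_sub_le {α 𝕜 : Type*} [MeasurableSpace α] [RCLike 𝕜] {μ : Measure α}
    [IsProbabilityMeasure μ] {f g : α → 𝕜} (hf : Integrable f μ) (hg : Integrable g μ)
    (hfg : Integrable (fun x => f x * (starRingEnd 𝕜) (g x)) μ) {c d : 𝕜} {R S : ℝ}
    (hR : ∀ᵐ x ∂μ, ‖f x - c‖ ≤ R) (hS : ∀ᵐ x ∂μ, ‖g x - d‖ ≤ S) :
    ‖(∫ x, f x * (starRingEnd 𝕜) (g x) ∂μ) -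
      (∫ x, f x ∂μ) * ∫ x, (starRingEnd 𝕜) (g x) ∂μ‖ ≤ R * S := by
  obtain ⟨x₀, hx₀⟩ := hS.exists
  have hS₀ : 0 ≤ S := (norm_nonneg _).trans hx₀
  set m : 𝕜 := ∫ y, f y ∂μ with hm
  have hg' : Integrable (fun x => (starRingEnd 𝕜) (g x)) μ :=
    (RCLike.conjLIE (K := 𝕜)).integrable_comp_iff.2 hg
  have hfm : Integrable (fun x => f x - m) μ := hf.sub (integrable_const m)
  have hcov : (∫ x, f x * (starRingEnd 𝕜) (g x) ∂μ) - m * ∫ x, (starRingEnd 𝕜) (g x) ∂μ =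
      ∫ x, (f x - m) * (starRingEnd 𝕜) (g x - d) ∂μ := by
    have : (fun x => (f x - m) * (starRingEnd 𝕜) (g x - d)) = fun x =>
        (f x * (starRingEnd 𝕜) (g x) - m * (starRingEnd 𝕜) (g x)) -
          (f x - m) * (starRingEnd 𝕜) d := by
      ext x
      rw [map_sub]
      ring
    have hdiff : Integrable (fun x => f x * (starRingEnd 𝕜) (g x) - m * (starRingEnd 𝕜) (g x)) μ :=
      hfg.sub (hg'.const_mul m)
    rw [this, integral_sub hdiff (hfm.mul_const _),
      integral_sub hfg (hg'.const_mul m), integral_const_mul, integral_mul_const,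
      integral_sub hf (integrable_const m)]
    simp [hm]
  rw [hcov]
  calc ‖∫ x, (f x - m) * (starRingEnd 𝕜) (g x - d) ∂μ‖ ≤ ∫ x, ‖f x - m‖ * S ∂μ := by
        refine norm_integral_le_of_norm_le (hfm.norm.mul_const S) ?_
        filter_upwards [hS] with x hx
        rw [norm_mul, RCLike.norm_conj]
        gcongr
    _ = (∫ x, ‖f x - m‖ ∂μ) * S := integral_mul_const _ _
    _ ≤ R * S := by
        gcongr
        exact integral_norm_sub_integral_le hf hR

theorem gruss_integral {𝕜 : Type*} [RCLike 𝕜] (a b : ℝ) (hab : a < b) (f g : ℝ → 𝕜)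
    (hf : IntegrableOn f (Set.Icc a b))
    (hg : IntegrableOn g (Set.Icc a b))
    (hfg : IntegrableOn (fun x => f x * (starRingEnd 𝕜) (g x)) (Set.Icc a b))
    (φ Φ γ Γ : 𝕜)
    (h1 : ∀ᵐ x ∂(volume.restrict (Set.Icc a b)),
      0 ≤ RCLike.re ((Φ - f x) * ((starRingEnd 𝕜) (f x) - (starRingEnd 𝕜) φ)))
    (h2 : ∀ᵐ x ∂(volume.restrict (Set.Icc a b)),
      0 ≤ RCLike.re ((Γ - g x) * ((starRingEnd 𝕜) (g x) - (starRingEnd 𝕜) γ))) :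
    ‖(b - a)⁻¹ • (∫ x in a..b, f x * (starRingEnd 𝕜) (g x)) -
        ((b - a)⁻¹ • (∫ x in a..b, f x)) *
          ((b - a)⁻¹ • (∫ x in a..b, (starRingEnd 𝕜) (g x)))‖ ≤
      1 / 4 * ‖Φ - φ‖ * ‖Γ - γ‖ := by
  set μ : Measure ℝ := ENNReal.ofReal (b - a)⁻¹ • volume.restrict (Set.Icc a b) with hμ
  have hba : 0 < b - a := sub_pos.2 hab
  have : IsProbabilityMeasure μ := ⟨by
    simp [hμ, ← ENNReal.ofReal_mul, inv_nonneg.2 hba.le, inv_mul_cancel₀ hba.ne']⟩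
  have hint (F : ℝ → 𝕜) : (b - a)⁻¹ • (∫ x in a..b, F x) = ∫ x, F x ∂μ := by
    rw [hμ, integral_smul_measure, ENNReal.toReal_ofReal (inv_nonneg.2 hba.le),
      intervalIntegral.integral_of_le hab.le, integral_Icc_eq_integral_Ioc]
  have hac : μ ≪ volume.restrict (Set.Icc a b) := Measure.smul_absolutelyContinuous
  rw [hint, hint, hint]
  calc _ ≤ ‖Φ - φ‖ / 2 * (‖Γ - γ‖ / 2) :=
        norm_integral_mul_conj_sub_le (hf.smul_measure ENNReal.ofReal_ne_top)
          (hg.smul_measure ENNReal.ofReal_ne_top) (hfg.smul_measure ENNReal.ofReal_ne_top)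
          (hac.ae_le (h1.mono fun _ => norm_sub_midpoint_le_of_re_nonneg))
          (hac.ae_le (h2.mono fun _ => norm_sub_midpoint_le_of_re_nonneg))
    _ = 1 / 4 * ‖Φ - φ‖ * ‖Γ - γ‖ := by ring
end

section
/- Let n ≥ 1, let x = (x₁,…,xₙ), y = (y₁,…,yₙ) ∈ 𝕜ⁿ, and let φ, Φ, γ, Γ ∈ 𝕜 satisfy Re[(Φ − xᵢ)(conj(xᵢ) − conj(φ))] ≥ 0 and Re[(Γ − yᵢ)(conj(yᵢ) − conj(γ))] ≥ 0 for each i ∈ {1,…,n}. Then |(1/n)∑ᵢ xᵢ·conj(yᵢ) − (1/n)∑ᵢ xᵢ · (1/n)∑ᵢ conj(yᵢ)| ≤ (1/4)·|Φ − φ|·|Γ − γ|. -/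
/-- The arithmetic mean minimizes the sum of squared distances to a finite family. -/
theorem sum_norm_sub_mean_sq_le {ι E : Type*} (𝕜 : Type*) [RCLike 𝕜] [NormedAddCommGroup E]
    [InnerProductSpace 𝕜 E] (s : Finset ι) (f : ι → E) (m c : E)
    (hm : ∑ i ∈ s, (f i - m) = 0) :
    ∑ i ∈ s, ‖f i - m‖ ^ 2 ≤ ∑ i ∈ s, ‖f i - c‖ ^ 2 := by
  have hcross : ∑ i ∈ s, RCLike.re (inner 𝕜 (f i - m) (m - c)) = 0 := by
    rw [← map_sum, ← sum_inner, hm, inner_zero_left, map_zero]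
  have hexp : ∀ i, ‖f i - c‖ ^ 2 =
      ‖f i - m‖ ^ 2 + 2 * RCLike.re (inner 𝕜 (f i - m) (m - c)) + ‖m - c‖ ^ 2 := fun i => by
    rw [← norm_add_sq, sub_add_sub_cancel]
  simp only [hexp, Finset.sum_add_distrib, ← Finset.mul_sum, hcross]
  have : 0 ≤ ∑ i ∈ s, ‖m - c‖ ^ 2 := by positivity
  linarith

/-- The condition `0 ≤ Re ((B - z) * conj (z - A))` places `z` in the closed ball with
diameter `[A, B]`. -/
theorem norm_sub_midpoint_sq_le {𝕜 : Type*} [RCLike 𝕜] {z A B : 𝕜}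
    (h : 0 ≤ RCLike.re ((B - z) * ((starRingEnd 𝕜) z - (starRingEnd 𝕜) A))) :
    ‖z - (2 : ℝ)⁻¹ • (A + B)‖ ^ 2 ≤ (‖B - A‖ / 2) ^ 2 := by
  rw [div_pow, RCLike.norm_sq_eq_def, RCLike.norm_sq_eq_def]
  simp only [RCLike.mul_re, map_sub, map_add, RCLike.conj_re, RCLike.conj_im, RCLike.smul_re,
    RCLike.smul_im] at h ⊢
  nlinarith

/-- A family of points satisfying the ball condition has standard deviation at most half the
diameter of the ball. -/
theorem sum_norm_sub_mean_sq_le_card_mul {ι 𝕜 : Type*} [RCLike 𝕜] (s : Finset ι) (f : ι → 𝕜)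
    (m A B : 𝕜) (hm : ∑ i ∈ s, (f i - m) = 0)
    (h : ∀ i, 0 ≤ RCLike.re ((B - f i) * ((starRingEnd 𝕜) (f i) - (starRingEnd 𝕜) A))) :
    ∑ i ∈ s, ‖f i - m‖ ^ 2 ≤ s.card * (‖B - A‖ / 2) ^ 2 := by
  refine (sum_norm_sub_mean_sq_le 𝕜 s f m ((2 : ℝ)⁻¹ • (A + B)) hm).trans ?_
  rw [← nsmul_eq_mul]
  exact Finset.sum_le_card_nsmul _ _ _ fun i _ => norm_sub_midpoint_sq_le (h i)

theorem gruss_discrete {𝕜 : Type*} [RCLike 𝕜] (n : ℕ) (hn : 1 ≤ n)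
    (x y : Fin n → 𝕜) (φ Φ γ Γ : 𝕜)
    (hx : ∀ i, 0 ≤ RCLike.re ((Φ - x i) * ((starRingEnd 𝕜) (x i) - (starRingEnd 𝕜) φ)))
    (hy : ∀ i, 0 ≤ RCLike.re ((Γ - y i) * ((starRingEnd 𝕜) (y i) - (starRingEnd 𝕜) γ))) :
    ‖(n : 𝕜)⁻¹ * (∑ i, x i * (starRingEnd 𝕜) (y i)) -
        ((n : 𝕜)⁻¹ * ∑ i, x i) * ((n : 𝕜)⁻¹ * ∑ i, (starRingEnd 𝕜) (y i))‖ ≤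
      1 / 4 * ‖Φ - φ‖ * ‖Γ - γ‖ := by
  have hn0 : (n : 𝕜) ≠ 0 := Nat.cast_ne_zero.mpr (by omega)
  have hnpos : (0 : ℝ) < n := Nat.cast_pos.mpr hn
  have hmean : ∀ f : Fin n → 𝕜, ∑ i, (f i - (n : 𝕜)⁻¹ * ∑ j, f j) = 0 := fun f => by
    simp [Finset.sum_sub_distrib, hn0]
  set mx := (n : 𝕜)⁻¹ * ∑ i, x i
  set my := (n : 𝕜)⁻¹ * ∑ i, y i with hmy
  have hmy_conj : (n : 𝕜)⁻¹ * ∑ i, (starRingEnd 𝕜) (y i) = (starRingEnd 𝕜) my := by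
    simp [hmy]
  have hcov : (n : 𝕜)⁻¹ * (∑ i, x i * (starRingEnd 𝕜) (y i)) - mx * (starRingEnd 𝕜) my =
      (n : 𝕜)⁻¹ * ∑ i, (x i - mx) * (starRingEnd 𝕜) (y i - my) := by
    have hsplit : ∀ i, (x i - mx) * (starRingEnd 𝕜) (y i - my) =
        x i * (starRingEnd 𝕜) (y i) - mx * (starRingEnd 𝕜) (y i) -
          (x i - mx) * (starRingEnd 𝕜) my := fun i => by rw [map_sub]; ring
    simp only [hsplit, Finset.sum_sub_distrib (f := fun i => _ - _), ← Finset.sum_mul]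
    rw [hmean x, Finset.sum_sub_distrib, ← Finset.mul_sum, ← hmy_conj]
    ring
  have hX := sum_norm_sub_mean_sq_le_card_mul Finset.univ x mx φ Φ (hmean x) hx
  have hY := sum_norm_sub_mean_sq_le_card_mul Finset.univ y my γ Γ (hmean y) hy
  rw [Finset.card_univ, Fintype.card_fin] at hX hY
  have hCS : ∑ i, ‖x i - mx‖ * ‖y i - my‖ ≤ n * (‖Φ - φ‖ / 2 * (‖Γ - γ‖ / 2)) := by
    refine le_of_sq_le_sq ?_ (by positivity)
    calc (∑ i, ‖x i - mx‖ * ‖y i - my‖) ^ 2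
        ≤ (∑ i, ‖x i - mx‖ ^ 2) * ∑ i, ‖y i - my‖ ^ 2 := Finset.sum_mul_sq_le_sq_mul_sq _ _ _
      _ ≤ (n * (‖Φ - φ‖ / 2) ^ 2) * (n * (‖Γ - γ‖ / 2) ^ 2) := by gcongr
      _ = (n * (‖Φ - φ‖ / 2 * (‖Γ - γ‖ / 2))) ^ 2 := by ring
  rw [hmy_conj, hcov, norm_mul, norm_inv, RCLike.norm_natCast, inv_mul_le_iff₀ hnpos]
  calc ‖∑ i, (x i - mx) * (starRingEnd 𝕜) (y i - my)‖
      ≤ ∑ i, ‖x i - mx‖ * ‖y i - my‖ := by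
        refine (norm_sum_le _ _).trans_eq (Finset.sum_congr rfl fun i _ => ?_)
        rw [norm_mul, RCLike.norm_conj]
    _ ≤ n * (‖Φ - φ‖ / 2 * (‖Γ - γ‖ / 2)) := hCS
    _ = n * (1 / 4 * ‖Φ - φ‖ * ‖Γ - γ‖) := by ring
end
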